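/- Let α ∈ (0,1). Then for every x > 0 one has Φ(x) < 1 = Φ(0); in particular Φ is bounded on [0,∞) by 1, a bound that does not depend on α. -/

import Mathlib

open MeasureTheory Real Set
/-- The function `Φ(x) = Σ (−1)ⁿ bₙ (x^{1+α}/(1+α))ⁿ`, where
`bₙ = ∏_{i<n} Γ(αi+i+2)/Γ(α(i+1)+i+2)`; it equals the generalized Mittag-Leffler
function `E_{α,1+1/α,1/α}(−x^{1+α}/(1+α))`. -/
noncomputable def PhiF (α : ℝ) (x : ℝ) : ℝ :=
  ∑' n : ℕ, (-1:ℝ)^n *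
    (∏ i ∈ Finset.range n, Real.Gamma (α * i + i + 2) / Real.Gamma (α * (i+1) + i + 2)) *
    (x ^ (1+α) / (1+α)) ^ n

/-- `Γ(y+1)/Γ(y+1+α) ≤ (y+α)^(-α)`, from the log-convexity of `Γ`. -/
theorem Gamma_div_Gamma_add_le {α y : ℝ} (h0 : 0 < α) (h1 : α < 1) (hy : 0 < y) :
    Real.Gamma (y + 1) / Real.Gamma (y + 1 + α) ≤ (y + α) ^ (-α) := by
  have hs : 0 < y + α := by positivity
  have h := Real.Gamma_mul_add_mul_le_rpow_Gamma_mul_rpow_Gamma hs (by positivity : 0 < y + α + 1)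
    h0 (sub_pos.2 h1) (by ring)
  have hG := Real.Gamma_pos_of_pos hs
  rw [show α * (y + α) + (1 - α) * (y + α + 1) = y + 1 by ring, Real.Gamma_add_one hs.ne',
    Real.mul_rpow hs.le hG.le, mul_left_comm, ← Real.rpow_add hG,
    show α + (1 - α) = 1 by ring, Real.rpow_one] at h
  rw [show y + 1 + α = y + α + 1 by ring, Real.Gamma_add_one hs.ne', div_le_iff₀ (by positivity)]
  calc _ ≤ _ := h
    _ = (y + α) ^ (-α) * (y + α) ^ (1 : ℝ) * Real.Gamma (y + α) := by
      rw [← Real.rpow_add hs, show -α + 1 = 1 - α by ring]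
    _ = _ := by rw [Real.rpow_one]; ring

/-- The Beta integral over `[0, a]` for real parameters. -/
theorem integral_rpow_mul_sub_rpow {s t a : ℝ} (hs : 0 < s) (ht : 0 < t) (ha : 0 < a) :
    ∫ x in (0:ℝ)..a, x ^ (s - 1) * (a - x) ^ (t - 1) =
      a ^ (s + t - 1) * (Real.Gamma s * Real.Gamma t / Real.Gamma (s + t)) := by
  apply Complex.ofReal_injective
  rw [← intervalIntegral.integral_ofReal]
  have h := Complex.betaIntegral_scaled s t ha
  rw [Complex.betaIntegral_eq_Gamma_mul_div _ _ (by simpa) (by simpa)] at h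
  push_cast
  rw [← Complex.Gamma_ofReal, ← Complex.Gamma_ofReal, ← Complex.Gamma_ofReal,
    Complex.ofReal_cpow ha.le]
  push_cast
  rw [← h]
  refine intervalIntegral.integral_congr fun x hx ↦ ?_
  rw [Set.uIcc_of_le ha.le] at hx
  rw [Complex.ofReal_cpow hx.1, Complex.ofReal_cpow (sub_nonneg.2 hx.2)]
  push_cast
  rfl

/-- The weakly singular kernel `(c - t)^(α-1)` times a continuous function is integrable. -/
theorem intervalIntegrable_sub_rpow_mul {α : ℝ} (h0 : 0 < α) {g : ℝ → ℝ} (hg : Continuous g)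
    (c a b : ℝ) : IntervalIntegrable (fun t ↦ (c - t) ^ (α - 1) * g t) volume a b := by
  have h : IntervalIntegrable (fun t : ℝ ↦ t ^ (α - 1)) volume (c - a) (c - b) :=
    intervalIntegral.intervalIntegrable_rpow' (r := α - 1) (by linarith)
  have h' := h.comp_sub_left c
  simp only [sub_sub_cancel] at h'
  exact h'.mul_continuousOn hg.continuousOn

/-- The coefficients `bₙ` of the series defining `PhiF`. -/
noncomputable def PhiCoeff (α : ℝ) (n : ℕ) : ℝ :=
  ∏ i ∈ Finset.range n, Real.Gamma (α * i + i + 2) / Real.Gamma (α * (i+1) + i + 2)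

theorem PhiCoeff_pos {α : ℝ} (h0 : 0 < α) (n : ℕ) : 0 < PhiCoeff α n :=
  Finset.prod_pos fun i _ ↦ div_pos (Real.Gamma_pos_of_pos (by positivity))
    (Real.Gamma_pos_of_pos (by positivity))

theorem PhiCoeff_succ (α : ℝ) (n : ℕ) : PhiCoeff α (n + 1) =
    PhiCoeff α n * (Real.Gamma (α * n + n + 2) / Real.Gamma (α * n + n + 2 + α)) := by
  rw [PhiCoeff, Finset.prod_range_succ, PhiCoeff]
  congr 3
  ring

open Filter Topology in
theorem tendsto_PhiCoeff_ratio {α : ℝ} (h0 : 0 < α) (h1 : α < 1) :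
    Tendsto (fun n ↦ PhiCoeff α (n + 1) / PhiCoeff α n) atTop (𝓝 0) := by
  have key (n : ℕ) : PhiCoeff α (n + 1) / PhiCoeff α n ≤ (α * n + n + 1 + α) ^ (-α) := by
    rw [PhiCoeff_succ, mul_div_cancel_left₀ _ (PhiCoeff_pos h0 n).ne']
    have := Gamma_div_Gamma_add_le h0 h1 (by positivity : 0 < α * n + n + 1)
    rwa [show α * n + n + 1 + 1 = α * n + n + 2 by ring] at this
  refine squeeze_zero (fun n ↦ (div_pos (PhiCoeff_pos h0 _) (PhiCoeff_pos h0 _)).le) key ?_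
  refine (tendsto_rpow_neg_atTop h0).comp (tendsto_atTop_mono (fun n ↦ ?_)
    tendsto_natCast_atTop_atTop)
  have : 0 ≤ α * n := by positivity
  linarith

open Filter Topology in
theorem radius_PhiCoeff {α : ℝ} (h0 : 0 < α) (h1 : α < 1) :
    (FormalMultilinearSeries.ofScalars ℝ fun n ↦ (-1) ^ n * PhiCoeff α n).radius = ⊤ := by
  refine FormalMultilinearSeries.ofScalars_radius_eq_top_of_tendsto _ _
    (Eventually.of_forall fun n ↦ ?_) ?_
  · have := PhiCoeff_pos h0 n
    positivity
  · simpa [abs_of_pos (PhiCoeff_pos h0 _)] using tendsto_PhiCoeff_ratio h0 h1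

theorem summable_PhiCoeff {α : ℝ} (h0 : 0 < α) (h1 : α < 1) (z : ℝ) :
    Summable fun n ↦ (-1) ^ n * PhiCoeff α n * z ^ n := by
  have h := FormalMultilinearSeries.summable
    (FormalMultilinearSeries.ofScalars ℝ fun n ↦ (-1) ^ n * PhiCoeff α n) (x := z)
    (by rw [radius_PhiCoeff h0 h1]; simp)
  simpa [FormalMultilinearSeries.ofScalars_apply_eq, mul_comm] using h

theorem differentiable_tsum_PhiCoeff {α : ℝ} (h0 : 0 < α) (h1 : α < 1) :
    Differentiable ℝ fun z : ℝ ↦ ∑' n : ℕ, (-1) ^ n * PhiCoeff α n * z ^ n := by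
  have h := (FormalMultilinearSeries.ofScalars ℝ fun n ↦
    (-1) ^ n * PhiCoeff α n).hasFPowerSeriesOnBall (by rw [radius_PhiCoeff h0 h1]; simp)
  rw [radius_PhiCoeff h0 h1] at h
  have h' := h.differentiableOn
  rw [Metric.eball_top, differentiableOn_univ] at h'
  rwa [← FormalMultilinearSeries.ofScalarsSum, FormalMultilinearSeries.ofScalarsSum_eq_tsum] at h'

theorem continuous_PhiF {α : ℝ} (h0 : 0 < α) (h1 : α < 1) : Continuous (PhiF α) :=
  (differentiable_tsum_PhiCoeff h0 h1).continuous.comp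
    ((Real.continuous_rpow_const (by positivity)).div_const (1 + α))

theorem differentiableAt_PhiF {α x : ℝ} (h0 : 0 < α) (h1 : α < 1) (hx : 0 < x) :
    DifferentiableAt ℝ (PhiF α) x :=
  ((differentiable_tsum_PhiCoeff h0 h1) _).comp x
    ((Real.differentiableAt_rpow_const_of_ne _ hx.ne').div_const (1 + α))

theorem PhiF_zero {α : ℝ} (h0 : 0 < α) : PhiF α 0 = 1 := by
  rw [PhiF, tsum_eq_single 0]
  · simp
  · intro n hn
    simp [Real.zero_rpow (by positivity : 1 + α ≠ 0), hn]

/-- `PhiF` solves a Volterra equation with the kernel `(x - t)^(α-1)`. -/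
theorem integral_sub_rpow_mul_PhiF {α x : ℝ} (h0 : 0 < α) (h1 : α < 1) (hx : 0 < x) :
    ∫ t in (0:ℝ)..x, (x - t) ^ (α - 1) * (t * PhiF α t) =
      (1 + α) * Real.Gamma α * (1 - PhiF α x) := by
  set a : ℕ → ℝ → ℝ := fun n t ↦ (-1) ^ n * PhiCoeff α n * (t ^ (1 + α) / (1 + α)) ^ n with ha
  have hΦ (t : ℝ) : PhiF α t = ∑' n, a n t := rfl
  have hcont (n : ℕ) : Continuous (a n) := continuous_const.mul
    (((Real.continuous_rpow_const (by positivity)).div_const (1 + α)).pow n)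
  set F : ℕ → ℝ → ℝ := fun n t ↦ (x - t) ^ (α - 1) * (t * a n t) with hF
  have hα : 1 + α ≠ 0 := by positivity
  have hint (n : ℕ) : IntervalIntegrable (F n) volume 0 x :=
    intervalIntegrable_sub_rpow_mul h0 (continuous_id.mul (hcont n)) x 0 x
  have hval (n : ℕ) : ∫ t in (0:ℝ)..x, F n t = -((1 + α) * Real.Gamma α) * a (n + 1) x := by
    have e : ∫ t in (0:ℝ)..x, F n t = ∫ t in (0:ℝ)..x, ((-1) ^ n * PhiCoeff α n / (1 + α) ^ n) *
        (t ^ ((α * n + n + 2) - 1) * (x - t) ^ (α - 1)) := by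
      refine intervalIntegral.integral_congr_ae (Filter.Eventually.of_forall fun t ht ↦ ?_)
      rw [Set.uIoc_of_le hx.le] at ht
      simp only [hF, ha, div_pow]
      rw [show α * n + n + 2 - 1 = (1 + α) * n + 1 by ring, Real.rpow_add ht.1 _ 1, Real.rpow_one,
        Real.rpow_mul ht.1.le, Real.rpow_natCast]
      field_simp
    rw [e, intervalIntegral.integral_const_mul,
      integral_rpow_mul_sub_rpow (by positivity) h0 hx]
    simp only [ha, div_pow]
    rw [PhiCoeff_succ, show α * n + n + 2 + α - 1 = (1 + α) * (n + 1 : ℕ) by push_cast; ring,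
      Real.rpow_mul hx.le, Real.rpow_natCast]
    field_simp
    ring
  have hsum : Summable fun n ↦ a n x := summable_PhiCoeff h0 h1 _
  have hsum' : Summable fun n ↦ -((1 + α) * Real.Gamma α) * a (n + 1) x :=
    ((summable_nat_add_iff 1).2 hsum).mul_left _
  have hnorm (n : ℕ) : ∫ t in Ioc 0 x, ‖F n t‖ = ‖∫ t in (0:ℝ)..x, F n t‖ := by
    have e : ∫ t in Ioc 0 x, ‖F n t‖ = (-1) ^ n * ∫ t in (0:ℝ)..x, F n t := by
      rw [intervalIntegral.integral_of_le hx.le, ← integral_const_mul]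
      refine setIntegral_congr_fun measurableSet_Ioc fun t ht ↦ ?_
      have hb := PhiCoeff_pos h0 n
      have h2 : 0 ≤ t ^ (1 + α) := Real.rpow_nonneg ht.1.le _
      have h3 : 0 ≤ (x - t) ^ (α - 1) := Real.rpow_nonneg (sub_nonneg.2 ht.2) _
      have h4 : 0 ≤ (x - t) ^ (α - 1) * (t * (PhiCoeff α n * (t ^ (1 + α) / (1 + α)) ^ n)) :=
        mul_nonneg h3 (mul_nonneg ht.1.le (by positivity))
      have h5 : F n t = (-1) ^ n *
          ((x - t) ^ (α - 1) * (t * (PhiCoeff α n * (t ^ (1 + α) / (1 + α)) ^ n))) := by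
        simp only [hF, ha]; ring
      rw [h5, norm_mul, norm_pow, norm_neg, norm_one, one_pow, one_mul, Real.norm_of_nonneg h4,
        ← mul_assoc ((-1) ^ n), ← mul_pow]
      simp
    have h6 : ‖∫ t in Ioc 0 x, ‖F n t‖‖ = ∫ t in Ioc 0 x, ‖F n t‖ :=
      Real.norm_of_nonneg (integral_nonneg fun _ ↦ norm_nonneg _)
    rw [← h6, e, norm_mul]
    simp
  have H := hasSum_integral_of_summable_integral_norm (F := F) (μ := volume.restrict (Ioc 0 x))
    (fun n ↦ (hint n).1) (by simp only [hnorm, hval]; exact hsum'.norm)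
  simp only [← intervalIntegral.integral_of_le hx.le, hval] at H
  have hL : ∀ t, (∑' n, F n t) = (x - t) ^ (α - 1) * (t * PhiF α t) := fun t ↦ by
    rw [hΦ, ← tsum_mul_left, ← tsum_mul_left]
  simp only [hL] at H
  rw [← H.tsum_eq, tsum_mul_left, hΦ, hsum.tsum_eq_zero_add]
  simp [ha, PhiCoeff]

/-- For `t < x < c`, passing from the kernel at `x` to that at `c` costs at least
the factor `(x/c)^(1-α)`. -/
theorem sub_rpow_le_mul_sub_rpow {α c x t : ℝ} (h1 : α < 1) (ht : 0 ≤ t) (htx : t < x)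
    (hxc : x ≤ c) : (c - t) ^ (α - 1) ≤ (x / c) ^ (1 - α) * (x - t) ^ (α - 1) := by
  have hx : 0 < x := ht.trans_lt htx
  have hc : 0 < c := hx.trans_le hxc
  have hxt : 0 < x - t := sub_pos.2 htx
  have hct : 0 < c - t := by linarith
  rw [show α - 1 = -(1 - α) by ring, Real.rpow_neg hct.le, Real.rpow_neg hxt.le,
    ← div_eq_mul_inv, ← Real.div_rpow (by positivity) hxt.le, ← Real.inv_rpow hct.le]
  refine Real.rpow_le_rpow (by positivity) ?_ (by linarith)
  rw [div_div, le_div_iff₀ (by positivity), inv_mul_le_iff₀ hct]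
  nlinarith

open Filter Topology in
theorem PhiF_pos {α x : ℝ} (h0 : 0 < α) (h1 : α < 1) (hx : 0 ≤ x) : 0 < PhiF α x := by
  by_contra! hneg
  have hcont := continuous_PhiF h0 h1
  -- the first point `c` where `PhiF` is nonpositive
  obtain ⟨c, ⟨⟨hc0, hcx⟩, hc⟩, hmin⟩ : ∃ c, IsLeast (Icc 0 x ∩ {t | PhiF α t ≤ 0}) c :=
    (isCompact_Icc.inter_right (isClosed_le hcont continuous_const)).exists_isLeast
      ⟨x, ⟨hx, le_rfl⟩, hneg⟩
  have hpos : ∀ t, 0 ≤ t → t < c → 0 < PhiF α t := fun t ht htc ↦ by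
    by_contra! h
    exact htc.not_ge (hmin ⟨⟨ht, htc.le.trans hcx⟩, h⟩)
  have hcpos : 0 < c := by
    refine hc0.lt_of_ne fun h ↦ ?_
    rw [← h, Set.mem_ofPred_eq, PhiF_zero h0] at hc
    linarith
  have hc_eq : PhiF α c = 0 := by
    refine le_antisymm hc (ge_of_tendsto (hcont.continuousWithinAt (s := Iio c)) ?_)
    filter_upwards [Ioo_mem_nhdsLT hcpos] with t ht using (hpos t ht.1.le ht.2).le
  obtain ⟨L, hL⟩ := (differentiableAt_PhiF h0 h1 hcpos).isBigO_sub.bound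
  set M : ℝ := (1 + α) * Real.Gamma α with hM
  have hMpos : 0 < M := mul_pos (by positivity) (Real.Gamma_pos_of_pos h0)
  obtain ⟨δ, hδ, hLδ⟩ := Metric.eventually_nhds_iff.1 hL
  have hsmall : ∀ᶠ h in 𝓝[>] (0:ℝ), c * |L| * h ^ α < M * ((1 - α) / c) := by
    have : Tendsto (fun h : ℝ ↦ c * |L| * h ^ α) (𝓝[>] 0) (𝓝 (c * |L| * 0 ^ α)) :=
      (((Real.continuous_rpow_const h0.le).tendsto 0).const_mul _).mono_left nhdsWithin_le_nhds
    rw [Real.zero_rpow h0.ne', mul_zero] at this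
    exact this.eventually_lt_const (mul_pos hMpos (div_pos (by linarith) hcpos))
  obtain ⟨h, hh, hh0, hhm⟩ :=
    (hsmall.and (Ioo_mem_nhdsGT (lt_min hδ hcpos))).exists
  have hhδ := hhm.trans_le (min_le_left _ _)
  have hhc := hhm.trans_le (min_le_right _ _)
  have hy : 0 < c - h := by linarith
  have hint (d a b : ℝ) :
      IntervalIntegrable (fun t ↦ (d - t) ^ (α - 1) * (t * PhiF α t)) volume a b :=
    intervalIntegrable_sub_rpow_mul h0 (continuous_id.mul hcont) d a b
  have Vc := integral_sub_rpow_mul_PhiF h0 h1 hcpos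
  have Vy := integral_sub_rpow_mul_PhiF h0 h1 hy
  rw [hc_eq, sub_zero, mul_one, ← intervalIntegral.integral_add_adjacent_intervals
    (hint c 0 (c - h)) (hint c (c - h) c)] at Vc
  have I1 : ∫ t in (0:ℝ)..(c - h), (c - t) ^ (α - 1) * (t * PhiF α t) ≤
      ((c - h) / c) ^ (1 - α) * ∫ t in (0:ℝ)..(c - h), (c - h - t) ^ (α - 1) * (t * PhiF α t) := by
    rw [← intervalIntegral.integral_const_mul]
    refine intervalIntegral.integral_mono_on_of_le_Ioo hy.le (hint _ _ _)
      ((hint _ _ _).const_mul _) fun t ht ↦ ?_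
    rw [← mul_assoc (_ ^ (1 - α))]
    exact mul_le_mul_of_nonneg_right (sub_rpow_le_mul_sub_rpow h1 ht.1.le ht.2 (sub_le_self c hh0.le))
      (mul_nonneg ht.1.le (hpos t ht.1.le (by linarith [ht.2])).le)
  have I2 : ∫ t in (c - h)..c, (c - t) ^ (α - 1) * (t * PhiF α t) ≤ h * (c * |L| * h ^ α) := by
    have : ∫ t in (c - h)..c, (c * |L| * h ^ α) = h * (c * |L| * h ^ α) := by
      rw [intervalIntegral.integral_const, sub_sub_cancel, smul_eq_mul]
    rw [← this]
    refine intervalIntegral.integral_mono_on_of_le_Ioo (by linarith) (hint _ _ _)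
      intervalIntegrable_const fun t ht ↦ ?_
    have hct : 0 < c - t := sub_pos.2 ht.2
    have ht0 : 0 < t := hy.trans ht.1
    have hb : PhiF α t ≤ |L| * (c - t) := by
      have := hLδ (y := t) (by rw [Real.dist_eq, abs_sub_comm, abs_of_pos hct]; linarith [ht.1])
      rw [hc_eq, sub_zero, Real.norm_eq_abs, Real.norm_eq_abs, abs_sub_comm t c,
        abs_of_pos hct] at this
      exact (le_abs_self _).trans (this.trans (mul_le_mul_of_nonneg_right (le_abs_self L) hct.le))
    calc (c - t) ^ (α - 1) * (t * PhiF α t)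
        ≤ (c - t) ^ (α - 1) * (c * (|L| * (c - t))) := by
          have := hpos t ht0.le ht.2
          have := ht.2.le
          gcongr
      _ = c * |L| * (c - t) ^ α := by
          rw [show (c - t) ^ α = (c - t) ^ (α - 1) * (c - t) by
            rw [← Real.rpow_add_one hct.ne', sub_add_cancel]]
          ring
      _ ≤ _ := by
          have : c - t ≤ h := by linarith [ht.1]
          gcongr
  have hfac : ((c - h) / c) ^ (1 - α) ≤ 1 - (1 - α) * (h / c) := by
    have hle : h / c ≤ 1 := (div_le_one hcpos).2 hhc.le
    have := rpow_one_add_le_one_add_mul_self (s := -(h / c)) (by linarith)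
      (p := 1 - α) (by linarith) (by linarith)
    rw [show (c - h) / c = 1 + -(h / c) by field_simp; ring]
    linarith
  rw [Vy] at I1
  have I3 : ((c - h) / c) ^ (1 - α) * (M * (1 - PhiF α (c - h))) ≤
      (1 - (1 - α) * (h / c)) * M := by
    have hP := hpos _ hy.le (by linarith)
    have hnn : 0 ≤ ((c - h) / c) ^ (1 - α) := by positivity
    calc _ ≤ ((c - h) / c) ^ (1 - α) * M := by
          refine mul_le_mul_of_nonneg_left ?_ hnn
          nlinarith
      _ ≤ _ := mul_le_mul_of_nonneg_right hfac hMpos.le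
  have I4 := mul_lt_mul_of_pos_left hh hh0
  have : h * (M * ((1 - α) / c)) = (1 - α) * (h / c) * M := by ring
  linarith

/-- `Φ(x) < 1 = Φ(0)` for `x > 0`; in particular `Φ ≤ 1` on `[0,∞)`,
a bound independent of `α`. -/
theorem Phi_lt_one (α : ℝ) (hα : α ∈ Set.Ioo (0:ℝ) 1) :
    (∀ x > (0:ℝ), PhiF α x < 1) ∧ PhiF α 0 = 1 ∧ ∀ x ≥ (0:ℝ), PhiF α x ≤ 1 := by
  obtain ⟨h0, h1⟩ := hα
  have hlt : ∀ x > (0:ℝ), PhiF α x < 1 := fun x hx ↦ by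
    have hI : 0 < ∫ t in (0:ℝ)..x, (x - t) ^ (α - 1) * (t * PhiF α t) :=
      intervalIntegral.intervalIntegral_pos_of_pos_on
        (intervalIntegrable_sub_rpow_mul h0 (continuous_id.mul (continuous_PhiF h0 h1)) x 0 x)
        (fun t ht ↦ mul_pos (Real.rpow_pos_of_pos (sub_pos.2 ht.2) _)
          (mul_pos ht.1 (PhiF_pos h0 h1 ht.1.le))) hx
    rw [integral_sub_rpow_mul_PhiF h0 h1 hx] at hI
    have := pos_of_mul_pos_right hI (mul_pos (by positivity) (Real.Gamma_pos_of_pos h0)).le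
    linarith
  refine ⟨hlt, PhiF_zero h0, fun x hx ↦ ?_⟩
  rcases hx.eq_or_lt with rfl | hx
  · exact (PhiF_zero h0).le
  · exact (hlt x hx).le
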